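/- Let ν be a Borel probability measure supported in (0,1]^d and r > 0. Suppose for some α > 0 and a sequence n_k → ∞ the counting numbers N_k := card{C ∈ D_{n_k} : ν(C)Λ(C)^{r/d} ≥ 2^{−α n_k}} satisfy lim_k log N_k / (n_k log 2) = F > 0. Then the upper quantization dimension satisfies D̄_r(ν) ≥ r(F/α)/(1 − F/α). -/

import Mathlib

open MeasureTheory Filter

/-- The half-open dyadic cube of generation `n` indexed by `k ∈ ℤ^d`. -/
def dyadicCube (d n : ℕ) (k : Fin d → ℤ) : Set (EuclideanSpace ℝ (Fin d)) :=
  {x | ∀ i, (k i : ℝ) * 2 ^ (-(n : ℤ)) < x i ∧ x i ≤ ((k i : ℝ) + 1) * 2 ^ (-(n : ℤ))}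

/-- `Σ_{C ∈ D_n} ν(C)^q`, with the convention `0^0 = 0` (cubes of measure zero
are discarded). -/
noncomputable def lqSum {d : ℕ} (ν : Measure (EuclideanSpace ℝ (Fin d)))
    (n : ℕ) (q : ℝ) : ℝ :=
  ∑' k : Fin d → ℤ,
    if ν (dyadicCube d n k) = 0 then 0 else (ν (dyadicCube d n k)).toReal ^ q

/-- The `n`-th approximation `β_{ν,n}(q) = log (Σ_{C ∈ D_n} ν(C)^q) / log 2^n`. -/
noncomputable def lqSpectrumN {d : ℕ} (ν : Measure (EuclideanSpace ℝ (Fin d)))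
    (n : ℕ) (q : ℝ) : ℝ :=
  Real.log (lqSum ν n q) / (n * Real.log 2)

/-- The `L^q`-spectrum `β_ν(q) = limsup_n β_{ν,n}(q)`. -/
noncomputable def lqSpectrum {d : ℕ} (ν : Measure (EuclideanSpace ℝ (Fin d)))
    (q : ℝ) : ℝ :=
  Filter.limsup (fun n : ℕ => lqSpectrumN ν n q) Filter.atTop

open Metric in
/-- The `n`-th quantization error of order `r`. -/
noncomputable def quantError {d : ℕ} (ν : Measure (EuclideanSpace ℝ (Fin d)))
    (n : ℕ) (r : ℝ) : ℝ :=
  sInf ((fun α : Finset (EuclideanSpace ℝ (Fin d)) =>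
      (∫ x, infDist x (α : Set (EuclideanSpace ℝ (Fin d))) ^ r ∂ν) ^ (1 / r)) ''
    {α : Finset (EuclideanSpace ℝ (Fin d)) | α.Nonempty ∧ α.card ≤ n})

/-- The upper quantization dimension `D̄_r(ν) = limsup_n log n / (- log e_{n,r}(ν))`. -/
noncomputable def upperQDim {d : ℕ} (ν : Measure (EuclideanSpace ℝ (Fin d)))
    (r : ℝ) : ℝ :=
  Filter.limsup (fun n : ℕ => Real.log n / (- Real.log (quantError ν n r))) Filter.atTop

/-- The lower quantization dimension `D̲_r(ν) = liminf_n log n / (- log e_{n,r}(ν))`. -/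
noncomputable def lowerQDim {d : ℕ} (ν : Measure (EuclideanSpace ℝ (Fin d)))
    (r : ℝ) : ℝ :=
  Filter.liminf (fun n : ℕ => Real.log n / (- Real.log (quantError ν n r))) Filter.atTop

section DyadicQuantization

open Metric

lemma measurableSet_dyadicCube (d n : ℕ) (k : Fin d → ℤ) : MeasurableSet (dyadicCube d n k) := by
  unfold dyadicCube
  simp only [Set.ofPred_forall]
  refine MeasurableSet.iInter fun i => ?_
  have hi : Measurable fun x : EuclideanSpace ℝ (Fin d) => x i := by fun_prop
  exact (measurableSet_lt measurable_const hi).inter (measurableSet_le hi measurable_const)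

lemma pairwise_disjoint_dyadicCube (d n : ℕ) :
    Pairwise (Function.onFun Disjoint (dyadicCube d n)) := by
  intro k l hkl
  refine Set.disjoint_left.2 fun x hk hl => hkl (funext fun i => ?_)
  have hh : (0 : ℝ) < 2 ^ (-(n : ℤ)) := by positivity
  have h1 : (k i : ℝ) < l i + 1 := lt_of_mul_lt_mul_right ((hk i).1.trans_le (hl i).2) hh.le
  have h2 : (l i : ℝ) < k i + 1 := lt_of_mul_lt_mul_right ((hl i).1.trans_le (hk i).2) hh.le
  have h3 : k i < l i + 1 := by exact_mod_cast h1
  have h4 : l i < k i + 1 := by exact_mod_cast h2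
  omega

/-- The indices of the `3 ^ d` cubes of generation `n` around the cube containing `p`. -/
noncomputable def dyadicNeighbors {d : ℕ} (n : ℕ) (p : EuclideanSpace ℝ (Fin d)) :
    Finset (Fin d → ℤ) :=
  Fintype.piFinset fun i =>
    Finset.Icc (⌈p i / 2 ^ (-(n : ℤ))⌉ - 2) ⌈p i / 2 ^ (-(n : ℤ))⌉

lemma card_dyadicNeighbors {d : ℕ} (n : ℕ) (p : EuclideanSpace ℝ (Fin d)) :
    (dyadicNeighbors n p).card = 3 ^ d := by
  unfold dyadicNeighbors
  rw [Fintype.card_piFinset]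
  simp

lemma le_dist_of_notMem_dyadicNeighbors {d n : ℕ} {p x : EuclideanSpace ℝ (Fin d)}
    {k : Fin d → ℤ} (hk : k ∉ dyadicNeighbors n p) (hx : x ∈ dyadicCube d n k) :
    (2 : ℝ) ^ (-(n : ℤ)) ≤ dist x p := by
  have hh : (0 : ℝ) < 2 ^ (-(n : ℤ)) := by positivity
  obtain ⟨i, hi⟩ : ∃ i, k i ∉ Finset.Icc (⌈p i / 2 ^ (-(n : ℤ))⌉ - 2) ⌈p i / 2 ^ (-(n : ℤ))⌉ := by
    by_contra! h
    exact hk (Fintype.mem_piFinset.2 h)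
  have hxi := hx i
  have hdist : |x i - p i| ≤ dist x p := by
    rw [dist_eq_norm]
    exact PiLp.norm_apply_le (x - p) i
  refine le_trans ?_ hdist
  set h : ℝ := 2 ^ (-(n : ℤ))
  set j : ℤ := ⌈p i / h⌉
  have hj1 : p i ≤ j * h := (div_le_iff₀ hh).1 (Int.le_ceil _)
  have hj2 : (j - 1) * h < p i := by
    have := Int.ceil_lt_add_one (p i / h)
    exact (lt_div_iff₀ hh).1 (by linarith)
  rw [Finset.mem_Icc, not_and_or, not_le, not_le] at hi
  rcases hi with hi | hi
  · have h1 : (k i : ℝ) ≤ j - 3 := by exact_mod_cast (by omega : k i ≤ j - 3)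
    rw [abs_sub_comm]
    refine le_trans ?_ (le_abs_self _)
    nlinarith [hxi.2]
  · have h1 : (j : ℝ) + 1 ≤ k i := by exact_mod_cast (by omega : j + 1 ≤ k i)
    refine le_trans ?_ (le_abs_self _)
    nlinarith [hxi.1]

lemma quantError_nonneg {d : ℕ} (ν : Measure (EuclideanSpace ℝ (Fin d))) (n : ℕ) (r : ℝ) :
    0 ≤ quantError ν n r := by
  refine Real.sInf_nonneg ?_
  rintro _ ⟨B, -, rfl⟩
  exact Real.rpow_nonneg (integral_nonneg fun x => Real.rpow_nonneg infDist_nonneg _) _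

variable {d : ℕ} (ν : Measure (EuclideanSpace ℝ (Fin d))) [IsProbabilityMeasure ν]

lemma integrable_infDist_rpow
    (hsupp : ν ({x : EuclideanSpace ℝ (Fin d) | ∀ i, x i ∈ Set.Ioc (0 : ℝ) 1}ᶜ) = 0)
    {r : ℝ} (hr : 0 < r) (A : Finset (EuclideanSpace ℝ (Fin d))) :
    Integrable (fun x => infDist x (A : Set (EuclideanSpace ℝ (Fin d))) ^ r) ν := by
  have hcont : Continuous fun x : EuclideanSpace ℝ (Fin d) =>
      infDist x (A : Set (EuclideanSpace ℝ (Fin d))) ^ r :=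
    (continuous_infDist_pt _).rpow_const fun _ => Or.inr hr.le
  refine Integrable.of_bound hcont.aestronglyMeasurable
    ((infDist 0 (A : Set (EuclideanSpace ℝ (Fin d))) + √d) ^ r) ?_
  have hae : ∀ᵐ x ∂ν, ∀ i, x i ∈ Set.Ioc (0 : ℝ) 1 := hsupp
  filter_upwards [hae] with x hx
  rw [Real.norm_of_nonneg (Real.rpow_nonneg infDist_nonneg _)]
  refine Real.rpow_le_rpow infDist_nonneg ?_ hr.le
  refine (infDist_le_infDist_add_dist (y := 0)).trans ?_
  gcongr
  rw [dist_zero_right, EuclideanSpace.norm_eq]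
  refine Real.sqrt_le_sqrt ?_
  calc ∑ i, ‖x i‖ ^ 2 ≤ ∑ _i : Fin d, (1 : ℝ) := by
        refine Finset.sum_le_sum fun i _ => ?_
        rw [Real.norm_of_nonneg (hx i).1.le]
        exact pow_le_one₀ (hx i).1.le (hx i).2
    _ = d := by simp

lemma le_integral_infDist_rpow
    (hsupp : ν ({x : EuclideanSpace ℝ (Fin d) | ∀ i, x i ∈ Set.Ioc (0 : ℝ) 1}ᶜ) = 0)
    {r c : ℝ} (hr : 0 < r) (hc : 0 ≤ c) (n : ℕ) (S : Finset (Fin d → ℤ))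
    (hS : ∀ k ∈ S, c ≤ (ν (dyadicCube d n k)).toReal * ((2 : ℝ) ^ (-(n : ℤ))) ^ r)
    (A : Finset (EuclideanSpace ℝ (Fin d))) (hA : A.Nonempty)
    (hcard : A.card * (2 * 3 ^ d) ≤ S.card) :
    (S.card : ℝ) / 2 * c ≤ ∫ x, infDist x (A : Set (EuclideanSpace ℝ (Fin d))) ^ r ∂ν := by
  classical
  set T := S \ A.biUnion (dyadicNeighbors n)
  have hint := integrable_infDist_rpow ν hsupp hr A
  have hnear : (A.biUnion (dyadicNeighbors n)).card ≤ A.card * 3 ^ d :=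
    Finset.card_biUnion_le_card_mul _ _ _ fun p _ => (card_dyadicNeighbors n p).le
  have hT : (S.card : ℝ) / 2 ≤ T.card := by
    have h1 := Finset.le_card_sdiff (A.biUnion (dyadicNeighbors n)) S
    have h2 : S.card ≤ 2 * T.card := by
      have : A.card * (2 * 3 ^ d) = 2 * (A.card * 3 ^ d) := by ring
      change _ ≤ T.card at h1
      omega
    have h3 : (S.card : ℝ) ≤ 2 * T.card := by exact_mod_cast h2
    linarith
  calc (S.card : ℝ) / 2 * c ≤ T.card * c := by gcongr
    _ = ∑ _k ∈ T, c := by simp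
    _ ≤ ∑ k ∈ T, ∫ x in dyadicCube d n k,
          infDist x (A : Set (EuclideanSpace ℝ (Fin d))) ^ r ∂ν := by
        refine Finset.sum_le_sum fun k hk => ?_
        obtain ⟨hkS, hkA⟩ := Finset.mem_sdiff.1 hk
        refine (hS k hkS).trans ?_
        rw [mul_comm]
        refine setIntegral_ge_of_const_le_real (measurableSet_dyadicCube d n k)
          (measure_ne_top _ _) (fun x hx => ?_) hint.integrableOn
        refine Real.rpow_le_rpow (by positivity) ?_ hr.le
        refine (le_infDist (by exact_mod_cast hA)).2 fun p hp => ?_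
        exact le_dist_of_notMem_dyadicNeighbors
          (fun h => hkA (Finset.mem_biUnion.2 ⟨p, hp, h⟩)) hx
    _ = ∫ x in ⋃ k ∈ T, dyadicCube d n k,
          infDist x (A : Set (EuclideanSpace ℝ (Fin d))) ^ r ∂ν :=
        (integral_biUnion_finset T (fun k _ => measurableSet_dyadicCube d n k)
          (fun k _ l _ hkl => pairwise_disjoint_dyadicCube d n hkl)
          fun k _ => hint.integrableOn).symm
    _ ≤ _ := setIntegral_le_integral hint
        (Eventually.of_forall fun x => Real.rpow_nonneg infDist_nonneg _)

lemma le_quantError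
    (hsupp : ν ({x : EuclideanSpace ℝ (Fin d) | ∀ i, x i ∈ Set.Ioc (0 : ℝ) 1}ᶜ) = 0)
    {r c : ℝ} (hr : 0 < r) (hc : 0 ≤ c) (n : ℕ) (S : Finset (Fin d → ℤ))
    (hS : ∀ k ∈ S, c ≤ (ν (dyadicCube d n k)).toReal * ((2 : ℝ) ^ (-(n : ℤ))) ^ r)
    {m : ℕ} (hm : 0 < m) (hcard : m * (2 * 3 ^ d) ≤ S.card) :
    ((S.card : ℝ) / 2 * c) ^ (1 / r) ≤ quantError ν m r := by
  refine le_csInf (Set.Nonempty.image _ ⟨{0}, by simp, by simpa using Nat.succ_le_of_lt hm⟩) ?_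
  rintro _ ⟨A, ⟨hA, hAm⟩, rfl⟩
  refine Real.rpow_le_rpow (by positivity) ?_ (by positivity)
  exact le_integral_infDist_rpow ν hsupp hr hc n S hS A hA
    ((Nat.mul_le_mul_right _ hAm).trans hcard)

lemma quantError_le
    (hsupp : ν ({x : EuclideanSpace ℝ (Fin d) | ∀ i, x i ∈ Set.Ioc (0 : ℝ) 1}ᶜ) = 0)
    {r : ℝ} (hr : 0 < r) {m n : ℕ} (hm : 0 < m) (hmn : m ^ d ≤ n) :
    quantError ν n r ≤ d / m := by
  classical
  have hm' : (0 : ℝ) < m := by exact_mod_cast hm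
  let g : (Fin d → Fin m) → EuclideanSpace ℝ (Fin d) :=
    fun a => WithLp.toLp 2 fun i => ((a i : ℕ) : ℝ) / m
  set A := Finset.univ.image g with hAdef
  have : Nonempty (Fin m) := ⟨⟨0, hm⟩⟩
  have hA : A.Nonempty := Finset.univ_nonempty.image g
  have hAn : A.card ≤ n := by
    refine Finset.card_image_le.trans ?_
    simpa using hmn
  have hbdd : BddBelow ((fun α : Finset (EuclideanSpace ℝ (Fin d)) =>
      (∫ x, infDist x (α : Set (EuclideanSpace ℝ (Fin d))) ^ r ∂ν) ^ (1 / r)) ''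
      {α : Finset (EuclideanSpace ℝ (Fin d)) | α.Nonempty ∧ α.card ≤ n}) := by
    refine ⟨0, ?_⟩
    rintro _ ⟨B, -, rfl⟩
    exact Real.rpow_nonneg (integral_nonneg fun x => Real.rpow_nonneg infDist_nonneg _) _
  refine (csInf_le hbdd ⟨A, ⟨hA, hAn⟩, rfl⟩).trans ?_
  have hae : ∀ᵐ x ∂ν, ∀ i, x i ∈ Set.Ioc (0 : ℝ) 1 := hsupp
  have hclose : ∀ᵐ x ∂ν,
      infDist x (A : Set (EuclideanSpace ℝ (Fin d))) ^ r ≤ ((d : ℝ) / m) ^ r := by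
    filter_upwards [hae] with x hx
    refine Real.rpow_le_rpow infDist_nonneg ?_ hr.le
    have hcoord (i : Fin d) : ∃ a : Fin m, |x i - ((a : ℕ) : ℝ) / m| ≤ 1 / m := by
      have hpos : 0 < x i * m := mul_pos (hx i).1 hm'
      have hle : x i * m ≤ m := mul_le_of_le_one_left hm'.le (hx i).2
      have hc0 : 0 < ⌈x i * m⌉₊ := Nat.ceil_pos.2 hpos
      have hc1 : ⌈x i * m⌉₊ ≤ m := Nat.ceil_le.2 hle
      refine ⟨⟨⌈x i * m⌉₊ - 1, by omega⟩, ?_⟩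
      have h1 := Nat.le_ceil (x i * m)
      have h2 := Nat.ceil_lt_add_one hpos.le
      have h3 : x i - ((⌈x i * m⌉₊ - 1 : ℕ) : ℝ) / m
          = (x i * m - (⌈x i * m⌉₊ - 1)) / m := by
        rw [Nat.cast_sub hc0]
        field_simp
        simp
      rw [h3, abs_div, abs_of_pos hm']
      gcongr
      rw [abs_le]
      constructor <;> linarith
    choose a ha using hcoord
    have hmem : g a ∈ (A : Set (EuclideanSpace ℝ (Fin d))) := by simp [hAdef]
    refine (infDist_le_dist_of_mem hmem).trans ?_
    rw [EuclideanSpace.dist_eq]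
    refine Real.sqrt_le_iff.2 ⟨by positivity, ?_⟩
    calc ∑ i, dist (x i) (g a i) ^ 2 ≤ ∑ _i : Fin d, (1 / (m : ℝ)) ^ 2 := by
          refine Finset.sum_le_sum fun i _ => pow_le_pow_left₀ dist_nonneg (ha i) 2
      _ = d * (1 / (m : ℝ)) ^ 2 := by simp
      _ ≤ (d : ℝ) ^ 2 * (1 / (m : ℝ)) ^ 2 := by
          gcongr
          exact_mod_cast Nat.le_self_pow two_ne_zero d
      _ = ((d : ℝ) / m) ^ 2 := by ring
  have hint : ∫ x, infDist x (A : Set (EuclideanSpace ℝ (Fin d))) ^ r ∂ν ≤ ((d : ℝ) / m) ^ r := by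
    calc _ ≤ ∫ _x, ((d : ℝ) / m) ^ r ∂ν :=
          integral_mono_ae (integrable_infDist_rpow ν hsupp hr A) (integrable_const _) hclose
      _ = _ := by simp
  calc _ ≤ (((d : ℝ) / m) ^ r) ^ (1 / r) :=
        Real.rpow_le_rpow (integral_nonneg fun x => Real.rpow_nonneg infDist_nonneg _) hint
          (by positivity)
    _ = d / m := by
        rw [one_div, Real.rpow_rpow_inv (by positivity) hr.ne']

lemma eventually_quantError_le_rpow (hd : 0 < d)
    (hsupp : ν ({x : EuclideanSpace ℝ (Fin d) | ∀ i, x i ∈ Set.Ioc (0 : ℝ) 1}ᶜ) = 0)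
    {r : ℝ} (hr : 0 < r) :
    ∀ᶠ n : ℕ in atTop, quantError ν n r ≤ (n : ℝ) ^ (-(1 / (2 * d) : ℝ)) := by
  have hd' : (0 : ℝ) < d := by exact_mod_cast hd
  have hlim : Tendsto (fun n : ℕ => (n : ℝ) ^ (1 / (2 * d) : ℝ)) atTop atTop :=
    (tendsto_rpow_atTop (by positivity)).comp tendsto_natCast_atTop_atTop
  filter_upwards [hlim.eventually_ge_atTop (2 * d), eventually_ge_atTop 1] with n hn hn1
  have hn0 : (0 : ℝ) < n := by exact_mod_cast hn1
  set y : ℝ := (n : ℝ) ^ (1 / (2 * d) : ℝ) with hy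
  have hy0 : 0 < y := by positivity
  have hyy : (n : ℝ) ^ (1 / d : ℝ) = y * y := by
    rw [hy, ← Real.rpow_add hn0]
    congr 1
    field_simp
    norm_num
  have h1 : (1 : ℝ) ≤ y * y := by
    rw [← hyy]
    exact Real.one_le_rpow (by exact_mod_cast hn1) (by positivity)
  set m := ⌊y * y⌋₊ with hm
  have hm0 : 0 < m := Nat.floor_pos.2 h1
  have hm0' : (1 : ℝ) ≤ m := by exact_mod_cast hm0
  have hmle : (m : ℝ) ≤ y * y := Nat.floor_le (by positivity)
  have hmlt : y * y < m + 1 := Nat.lt_floor_add_one _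
  have hmn : m ^ d ≤ n := by
    have : (m : ℝ) ^ d ≤ n := by
      calc (m : ℝ) ^ d ≤ (y * y) ^ d := by gcongr
        _ = n := by rw [← hyy, one_div, Real.rpow_inv_natCast_pow hn0.le hd.ne']
    exact_mod_cast this
  refine (quantError_le ν hsupp hr hm0 hmn).trans ?_
  rw [Real.rpow_neg hn0.le, ← hy, div_le_iff₀ (by linarith), inv_mul_eq_div, le_div_iff₀ hy0]
  nlinarith

lemma isBoundedUnder_log_div_neg_log_quantError (hd : 0 < d)
    (hsupp : ν ({x : EuclideanSpace ℝ (Fin d) | ∀ i, x i ∈ Set.Ioc (0 : ℝ) 1}ᶜ) = 0)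
    {r : ℝ} (hr : 0 < r) :
    IsBoundedUnder (· ≤ ·) atTop
      (fun n : ℕ => Real.log n / (- Real.log (quantError ν n r))) := by
  have hd' : (0 : ℝ) < d := by exact_mod_cast hd
  refine ⟨2 * d, eventually_map.2 ?_⟩
  filter_upwards [eventually_quantError_le_rpow ν hd hsupp hr, eventually_ge_atTop 2] with n hn hn2
  have hn0 : (0 : ℝ) < n := by positivity
  have hlog : 0 < Real.log n := Real.log_pos (by exact_mod_cast hn2)
  rcases (quantError_nonneg ν n r).eq_or_lt with h0 | h0
  · rw [← h0]
    simp
  · have h1 := Real.log_le_log h0 hn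
    rw [Real.log_rpow hn0] at h1
    have h2 : 1 / (2 * d) * Real.log n ≤ -Real.log (quantError ν n r) := by linarith
    have h3 : 0 < 1 / (2 * (d : ℝ)) * Real.log n := by positivity
    rw [div_le_iff₀ (h3.trans_le h2)]
    calc Real.log n = 2 * d * (1 / (2 * d) * Real.log n) := by field_simp
      _ ≤ _ := by gcongr

lemma card_mul_le_of_dyadicCube {r c : ℝ} (n : ℕ) (S : Finset (Fin d → ℤ))
    (hS : ∀ k ∈ S, c ≤ (ν (dyadicCube d n k)).toReal * ((2 : ℝ) ^ (-(n : ℤ))) ^ r) :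
    S.card * c ≤ ((2 : ℝ) ^ (-(n : ℤ))) ^ r := by
  calc S.card * c = ∑ _k ∈ S, c := by simp
    _ ≤ ∑ k ∈ S, ν.real (dyadicCube d n k) * ((2 : ℝ) ^ (-(n : ℤ))) ^ r := Finset.sum_le_sum hS
    _ = ν.real (⋃ k ∈ S, dyadicCube d n k) * ((2 : ℝ) ^ (-(n : ℤ))) ^ r := by
        rw [← Finset.sum_mul, measureReal_biUnion_finset
          (fun k _ l _ hkl => pairwise_disjoint_dyadicCube d n hkl)
          fun k _ => measurableSet_dyadicCube d n k]
    _ ≤ 1 * ((2 : ℝ) ^ (-(n : ℤ))) ^ r := by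
        gcongr
        exact measureReal_le_one
    _ = _ := one_mul _

end DyadicQuantization

/-- Coarse multifractal lower bound: if along a sequence `n_k → ∞` the number
`N_k` of generation-`n_k` dyadic cubes with `ν(C) Λ(C)^{r/d} ≥ 2^{-α n_k}`
satisfies `log N_k / (n_k log 2) → F > 0`, then
`D̄_r(ν) ≥ r (F/α) / (1 - F/α)`. -/
theorem upperQDim_coarse_lower_bound {d : ℕ} (ν : Measure (EuclideanSpace ℝ (Fin d)))
    [IsProbabilityMeasure ν]
    (hsupp : ν ({x : EuclideanSpace ℝ (Fin d) | ∀ i, x i ∈ Set.Ioc (0 : ℝ) 1}ᶜ) = 0)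
    (r α F : ℝ) (hr : 0 < r) (hα : 0 < α) (hF : 0 < F)
    (nseq : ℕ → ℕ) (hnseq : Filter.Tendsto nseq Filter.atTop Filter.atTop)
    (hcount : Filter.Tendsto (fun j : ℕ =>
        Real.log (Set.ncard {k : Fin d → ℤ |
          (2 : ℝ) ^ (-(α * (nseq j : ℝ))) ≤
            (ν (dyadicCube d (nseq j) k)).toReal *
              ((2 : ℝ) ^ (-(nseq j : ℤ))) ^ r}) / ((nseq j : ℝ) * Real.log 2))
      Filter.atTop (nhds F)) :
    r * (F / α) / (1 - F / α) ≤ upperQDim ν r := by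
  set S : ℕ → Set (Fin d → ℤ) := fun j => {k : Fin d → ℤ |
    (2 : ℝ) ^ (-(α * (nseq j : ℝ))) ≤
      (ν (dyadicCube d (nseq j) k)).toReal * ((2 : ℝ) ^ (-(nseq j : ℤ))) ^ r} with hSdef
  set N : ℕ → ℕ := fun j => (S j).ncard
  set t : ℕ → ℝ := fun j => (nseq j : ℝ) * Real.log 2 with ht
  change Tendsto (fun j => Real.log (N j) / t j) atTop (nhds F) at hcount
  have hlog2 : 0 < Real.log 2 := Real.log_pos one_lt_two
  have htop : Tendsto t atTop atTop :=
    (tendsto_natCast_atTop_atTop.comp hnseq).atTop_mul_const hlog2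
  have hNlog : Tendsto (fun j => Real.log (N j)) atTop atTop := by
    refine (hcount.pos_mul_atTop hF htop).congr' ?_
    filter_upwards [htop.eventually_gt_atTop 0] with j hj
    field_simp
  have hNtop : Tendsto N atTop atTop := by
    rw [← tendsto_natCast_atTop_iff (R := ℝ)]
    exact tendsto_atTop_mono (fun j => Real.log_le_self (Nat.cast_nonneg _)) hNlog
  have hfin (j : ℕ) (hj : 0 < N j) : ∃ s : Finset (Fin d → ℤ), (s : Set _) = S j ∧
      s.card = N j := by
    have hf : (S j).Finite := Set.finite_of_ncard_pos hj
    exact ⟨hf.toFinset, hf.coe_toFinset, (Set.ncard_eq_toFinset_card _ hf).symm⟩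
  have hlogc (j : ℕ) : Real.log ((2 : ℝ) ^ (-(α * (nseq j : ℝ)))) = -(α * t j) := by
    rw [Real.log_rpow two_pos, ht]
    ring
  have hFα : F ≤ α - r := by
    refine le_of_tendsto hcount ?_
    filter_upwards [hNtop.eventually_gt_atTop 0, htop.eventually_gt_atTop 0] with j hj htj
    obtain ⟨s, hs, hcard⟩ := hfin j hj
    have h := card_mul_le_of_dyadicCube ν (nseq j) s fun k hk => by
      have : k ∈ S j := hs ▸ hk
      exact this
    rw [hcard] at h
    have hj' : (0 : ℝ) < N j := by exact_mod_cast hj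
    have h2 := Real.log_le_log (by positivity) h
    rw [Real.log_mul hj'.ne' (by positivity), hlogc, Real.log_rpow (by positivity),
      Real.log_zpow] at h2
    rw [div_le_iff₀ htj]
    have h3 : r * (((-(nseq j : ℤ) : ℤ) : ℝ) * Real.log 2) = -(r * t j) := by
      rw [ht]
      push_cast
      ring
    linarith
  have hd : 0 < d := by
    rcases Nat.eq_zero_or_pos d with rfl | hd
    · obtain ⟨j, hj⟩ := (hNtop.eventually_gt_atTop 1).exists
      have h1 : (S j).ncard ≤ 1 := Set.ncard_le_one_of_subsingleton (S j)
      exact absurd hj (not_lt.2 h1)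
    · exact hd
  set m : ℕ → ℕ := fun j => N j / (2 * 3 ^ d) with hm
  have hmtop : Tendsto m atTop atTop :=
    (Nat.tendsto_div_const_atTop (by positivity)).comp hNtop
  set K : ℝ := Real.log (4 * 3 ^ d) with hK
  set v : ℕ → ℝ := fun j => (Real.log (N j) / t j - K / t j) /
    (1 / r * (α - Real.log (N j) / t j + Real.log 2 / t j)) with hv
  have hvlim : Tendsto v atTop (nhds (r * (F / α) / (1 - F / α))) := by
    have hαF : 0 < α - F := by linarith
    have heq : r * (F / α) / (1 - F / α) = (F - 0) / (1 / r * (α - F + 0)) := by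
      have : 1 - F / α ≠ 0 := by
        rw [one_sub_div hα.ne']
        positivity
      rw [sub_zero, add_zero]
      field_simp
    rw [heq]
    refine (hcount.sub (htop.const_div_atTop K)).div
      (((hcount.const_sub α).add (htop.const_div_atTop _)).const_mul _) ?_
    rw [add_zero]
    positivity
  have hle : ∀ᶠ j in atTop,
      v j ≤ Real.log (m j) / (- Real.log (quantError ν (m j) r)) := by
    filter_upwards [hNtop.eventually_gt_atTop 0, htop.eventually_gt_atTop 0,
      hmtop.eventually_ge_atTop 2,
      hmtop.eventually (eventually_quantError_le_rpow ν hd hsupp hr)] with j hj htj hmj hquant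
    obtain ⟨s, hs, hcard⟩ := hfin j hj
    have hj' : (0 : ℝ) < N j := by exact_mod_cast hj
    have hm0 : (0 : ℝ) < m j := by positivity
    have hm2 : (1 : ℝ) < m j := by exact_mod_cast hmj
    have h := le_quantError ν hsupp hr
      (c := (2 : ℝ) ^ (-(α * (nseq j : ℝ)))) (by positivity) (nseq j) s
      (fun k hk => by
        have : k ∈ S j := hs ▸ hk
        exact this)
      (m := m j) (by omega) (by rw [hcard]; exact Nat.div_mul_le_self _ _)
    rw [hcard] at h
    have hpos : 0 < quantError ν (m j) r := lt_of_lt_of_le (by positivity) h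
    have hlow := Real.log_le_log (by positivity) h
    rw [Real.log_rpow (by positivity), Real.log_mul (by positivity) (by positivity),
      Real.log_div hj'.ne' two_ne_zero, hlogc] at hlow
    have hlogm : 0 < Real.log (m j) := Real.log_pos hm2
    have hden : 0 < -Real.log (quantError ν (m j) r) := by
      have h1 : quantError ν (m j) r < 1 :=
        hquant.trans_lt (Real.rpow_lt_one_of_one_lt_of_neg hm2 (by
          have : (0 : ℝ) < 1 / (2 * d) := by positivity
          linarith))
      linarith [Real.log_neg hpos h1]
    have hnum : Real.log (N j) - K ≤ Real.log (m j) := by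
      rw [hK, ← Real.log_div hj'.ne' (by positivity)]
      refine Real.log_le_log (by positivity) ?_
      rw [div_le_iff₀ (by positivity)]
      have h1 : N j ≤ m j * (4 * 3 ^ d) := by
        have h2 : N j < (m j + 1) * (2 * 3 ^ d) := by
            rw [mul_comm]
            exact Nat.lt_mul_div_succ _ (by positivity)
        nlinarith [Nat.zero_le (m j * 3 ^ d), pow_pos (show 0 < 3 by norm_num) d]
      exact_mod_cast h1
    have hveq : v j = (Real.log (N j) - K) / (1 / r * (α * t j - Real.log (N j) + Real.log 2)) := by
      rw [hv]
      change (Real.log (N j) / t j - K / t j) /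
        (1 / r * (α - Real.log (N j) / t j + Real.log 2 / t j)) = _
      rw [← mul_div_mul_right _ (1 / r * (α - _ + _)) htj.ne']
      congr 1 <;> field_simp
    rw [hveq]
    refine div_le_div₀ hlogm.le hnum hden ?_
    have : 1 / r * (α * t j - Real.log (N j) + Real.log 2)
        = -(1 / r * (Real.log (N j) - Real.log 2 + -(α * t j))) := by ring
    rw [this]
    linarith
  refine le_of_forall_lt fun b hb => ?_
  obtain ⟨b', hbb', hb'⟩ := exists_between hb
  refine hbb'.trans_le ?_
  refine Filter.le_limsup_of_frequently_le ?_
    (isBoundedUnder_log_div_neg_log_quantError ν hd hsupp hr)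
  refine hmtop.frequently (Eventually.frequently ?_)
  filter_upwards [hle, hvlim.eventually (lt_mem_nhds hb')] with j h1 h2
  exact h2.le.trans h1
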